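/- There is an absolute constant c₃ > 0 such that for every even L ≥ 2 and every m ∈ {1,…,L}, the random variable Y_m(η) := ∑_{ℓ=0}^{m−1} η_{(ℓe₁,(ℓ+1)e₁)} satisfies Var_{μ_L}(Y_m) ≤ Var_{μ*_L}(Y_m) ≤ c₃ (1 + log m). -/

import Mathlib

open MeasureTheory Real Filter
open scoped ENNReal

noncomputable section

abbrev Torus (L : ℕ) := ZMod L × ZMod L
abbrev Edge (L : ℕ) := Torus L × Bool
def estep (L : ℕ) (d : Bool) : Torus L := if d then (1, 0) else (0, 1)
def etarget {L : ℕ} (e : Edge L) : Torus L := e.1 + estep L e.2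
def grad {L : ℕ} (φ : Torus L → ℝ) : Edge L → ℝ := fun e => φ (etarget e) - φ e.1

def nuL (L : ℕ) [NeZero L] : Measure (Edge L → ℝ) :=
  Measure.map (fun φ : Torus L → ℝ => grad φ)
    (Measure.map
      (fun ψ : {x : Torus L // x ≠ 0} → ℝ => fun x : Torus L =>
        if h : x = 0 then (0 : ℝ) else ψ ⟨x, h⟩)
      volume)

def energy (L : ℕ) [NeZero L] (κ η : Edge L → ℝ) : ℝ :=
  (1 / 2) * ∑ b : Edge L, κ b * η b ^ 2

def ZL (L : ℕ) [NeZero L] (κ : Edge L → ℝ) : ℝ≥0∞ :=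
  ∫⁻ η, ENNReal.ofReal (Real.exp (-(energy L κ η))) ∂(nuL L)

/-- Product a priori measure on the `κ`'s. -/
def rhoL (L : ℕ) [NeZero L] (ρ : Measure ℝ) : Measure (Edge L → ℝ) :=
  Measure.pi fun _ : Edge L => ρ

/-- Partition function of the extended model. -/
def ZLV (L : ℕ) [NeZero L] (ρ : Measure ℝ) : ℝ≥0∞ :=
  ∫⁻ x : (Edge L → ℝ) × (Edge L → ℝ),
    ENNReal.ofReal (Real.exp (-(energy L x.2 x.1))) ∂((nuL L).prod (rhoL L ρ))

/-- The extended gradient Gibbs measure `Q_L` on pairs `(η, κ)`. -/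
def QL (L : ℕ) [NeZero L] (ρ : Measure ℝ) : Measure ((Edge L → ℝ) × (Edge L → ℝ)) :=
  (ZLV L ρ)⁻¹ •
    (((nuL L).prod (rhoL L ρ)).withDensity fun x =>
      ENNReal.ofReal (Real.exp (-(energy L x.2 x.1))))

/-- The `η`-marginal `P_L` of `Q_L`. -/
def PL (L : ℕ) [NeZero L] (ρ : Measure ℝ) : Measure (Edge L → ℝ) :=
  (QL L ρ).map Prod.fst

/-- Topological support of a measure on `ℝ`. -/
def measSupport (ρ : Measure ℝ) : Set ℝ := {x | ∀ U ∈ nhds x, 0 < ρ U}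

/-- The a priori measure `ν*_L`: pushforward of `ν_L ⊗ Leb(ℝ²)` under
`(ζ,(s,t)) ↦ η` with `η_b = ζ_b + s/L²` (horizontal `b`) or `ζ_b + t/L²`
(vertical `b`). -/
def nuStar (L : ℕ) [NeZero L] : Measure (Edge L → ℝ) :=
  Measure.map
    (fun q : (Edge L → ℝ) × (ℝ × ℝ) => fun b : Edge L =>
      q.1 b + (if b.2 then q.2.1 else q.2.2) / (L : ℝ) ^ 2)
    ((nuL L).prod volume)

/-- The standard Gaussian gradient measure `μ_L` (unit stiffness), relative to
the a priori measure `ν_L`. -/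
def muL (L : ℕ) [NeZero L] : Measure (Edge L → ℝ) :=
  (∫⁻ η, ENNReal.ofReal (Real.exp (-(energy L (fun _ => 1) η))) ∂(nuL L))⁻¹ •
    ((nuL L).withDensity fun η =>
      ENNReal.ofReal (Real.exp (-(energy L (fun _ => 1) η))))

/-- The standard Gaussian gradient measure `μ*_L` relative to `ν*_L`. -/
def muLstar (L : ℕ) [NeZero L] : Measure (Edge L → ℝ) :=
  (∫⁻ η, ENNReal.ofReal (Real.exp (-(energy L (fun _ => 1) η))) ∂(nuStar L))⁻¹ •
    ((nuStar L).withDensity fun η =>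
      ENNReal.ofReal (Real.exp (-(energy L (fun _ => 1) η))))

/-- `Y_m = ∑_{ℓ=0}^{m−1} η_{(ℓe₁,(ℓ+1)e₁)}`. -/
def Ym (L : ℕ) [NeZero L] (m : ℕ) (η : Edge L → ℝ) : ℝ :=
  ∑ ℓ ∈ Finset.range m, η (((ℓ : ZMod L), 0), true)

section GaussianMeasure

open Module ProbabilityTheory

variable {E : Type*} [NormedAddCommGroup E] [InnerProductSpace ℝ E] [FiniteDimensional ℝ E]
  [MeasurableSpace E] [BorelSpace E]

/-- The normalized Gaussian density gives the standard Gaussian measure. -/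
lemma normalized_volume_withDensity_eq_stdGaussian :
    (∫⁻ v : E, ENNReal.ofReal (Real.exp (-(1 / 2 * ‖v‖ ^ 2))))⁻¹ •
      (volume : Measure E).withDensity (fun v => ENNReal.ofReal (Real.exp (-(1 / 2 * ‖v‖ ^ 2)))) =
      stdGaussian E := by
  have hint : ∫ v : E, Real.exp (-(1 / 2 * ‖v‖ ^ 2)) =
      (π / (1 / 2)) ^ (finrank ℝ E / 2 : ℝ) := by
    rw [← GaussianFourier.integral_rexp_neg_mul_sq_norm (by norm_num : (0 : ℝ) < 1 / 2)]
    simp only [neg_mul]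
  have hpos : 0 < ∫ v : E, Real.exp (-(1 / 2 * ‖v‖ ^ 2)) := by
    rw [hint]; positivity
  have hi : Integrable (fun v : E => Real.exp (-(1 / 2 * ‖v‖ ^ 2))) := by
    by_contra h
    rw [integral_undef h] at hpos
    exact hpos.false
  have hZ : ∫⁻ v : E, ENNReal.ofReal (Real.exp (-(1 / 2 * ‖v‖ ^ 2))) =
      ENNReal.ofReal (∫ v : E, Real.exp (-(1 / 2 * ‖v‖ ^ 2))) :=
    (ofReal_integral_eq_lintegral_ofReal hi (ae_of_all _ fun _ => (Real.exp_pos _).le)).symm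
  have hfin : IsFiniteMeasure ((∫⁻ v : E, ENNReal.ofReal (Real.exp (-(1 / 2 * ‖v‖ ^ 2))))⁻¹ •
      (volume : Measure E).withDensity
        (fun v => ENNReal.ofReal (Real.exp (-(1 / 2 * ‖v‖ ^ 2))))) := by
    have := isFiniteMeasure_withDensity_ofReal hi.2
    refine Measure.smul_finite _ ?_
    rw [hZ]
    simpa using hpos
  apply Measure.ext_of_charFun
  ext t
  rw [charFun_stdGaussian, charFun_apply, integral_smul_measure,
    integral_withDensity_eq_integral_toReal_smul (by fun_prop) (by simp), hZ, hint]
  have key := GaussianFourier.integral_cexp_neg_mul_sq_norm_add (V := E) (b := 1 / 2)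
    (by norm_num) Complex.I t
  have hfun : (fun v : E => (ENNReal.ofReal (Real.exp (-(1 / 2 * ‖v‖ ^ 2)))).toReal •
      Complex.exp (inner ℝ v t * Complex.I)) =
      fun v : E => Complex.exp (-(1 / 2) * ‖v‖ ^ 2 + Complex.I * inner ℝ t v) := by
    ext v
    rw [ENNReal.toReal_ofReal (Real.exp_pos _).le, Complex.real_smul, Complex.ofReal_exp,
      ← Complex.exp_add, real_inner_comm]
    push_cast
    ring_nf
  rw [hfun, key]
  have hc : ((π : ℂ) / (1 / 2)) ^ (finrank ℝ E / 2 : ℂ) =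
      (((π / (1 / 2)) ^ (finrank ℝ E / 2 : ℝ) : ℝ) : ℂ) := by
    rw [Complex.ofReal_cpow (by positivity)]
    push_cast
    rfl
  have hne : (0 : ℝ) < (π / (1 / 2)) ^ (finrank ℝ E / 2 : ℝ) := by positivity
  rw [hc, ENNReal.toReal_inv, ENNReal.toReal_ofReal hne.le, Complex.real_smul, ← mul_assoc,
    ← Complex.ofReal_mul, inv_mul_cancel₀ hne.ne', Complex.ofReal_one, one_mul]
  congr 1
  rw [Complex.I_sq]
  ring

/-- The normalization makes the choice of Haar measure irrelevant. -/
lemma normalized_addHaar_withDensity_eq_stdGaussian (m : Measure E) [m.IsAddHaarMeasure] :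
    (∫⁻ v : E, ENNReal.ofReal (Real.exp (-(1 / 2 * ‖v‖ ^ 2))) ∂m)⁻¹ •
      m.withDensity (fun v => ENNReal.ofReal (Real.exp (-(1 / 2 * ‖v‖ ^ 2)))) =
      stdGaussian E := by
  rw [← normalized_volume_withDensity_eq_stdGaussian]
  have hm := Measure.isAddLeftInvariant_eq_smul m (volume : Measure E)
  have hc : m.addHaarScalarFactor (volume : Measure E) ≠ 0 :=
    (Measure.addHaarScalarFactor_pos_of_isAddHaarMeasure m volume).ne'
  generalize m.addHaarScalarFactor (volume : Measure E) = c at hm hc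
  rw [hm, ENNReal.smul_def, lintegral_smul_measure, withDensity_smul_measure, smul_smul,
    smul_eq_mul, ENNReal.mul_inv (.inl (by simpa using hc)) (.inl (by simp)), mul_comm,
    ← mul_assoc, ENNReal.mul_inv_cancel (by simpa using hc) (by simp), one_mul]

lemma withDensity_map {α β : Type*} [MeasurableSpace α] [MeasurableSpace β] (m : Measure α)
    {g : α → β} (hg : Measurable g) {f : β → ℝ≥0∞} (hf : Measurable f) :
    (m.map g).withDensity f = (m.withDensity (f ∘ g)).map g := by
  ext s hs
  rw [withDensity_apply _ hs, setLIntegral_map hs hf hg, Measure.map_apply hg hs,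
    withDensity_apply _ (hg hs)]
  rfl

variable {V V' ι : Type*} [Fintype ι]
  [NormedAddCommGroup V] [NormedSpace ℝ V] [FiniteDimensional ℝ V] [MeasurableSpace V]
  [BorelSpace V]
  [NormedAddCommGroup V'] [NormedSpace ℝ V'] [FiniteDimensional ℝ V'] [MeasurableSpace V']
  [BorelSpace V']

/-- The image of `m` under `G`, weighted by the standard Gaussian density and normalized. -/
def gaussianImage (m : Measure V) (G : V →ₗ[ℝ] ι → ℝ) : Measure (ι → ℝ) :=
  (∫⁻ η, ENNReal.ofReal (Real.exp (-(1 / 2 * ∑ b, η b ^ 2))) ∂(m.map G))⁻¹ •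
    (m.map G).withDensity fun η => ENNReal.ofReal (Real.exp (-(1 / 2 * ∑ b, η b ^ 2)))

/-- The range of `G` as a subspace of Euclidean space. -/
def euclideanRange (G : V →ₗ[ℝ] ι → ℝ) : Submodule ℝ (EuclideanSpace ℝ ι) :=
  LinearMap.range ((WithLp.linearEquiv 2 ℝ (ι → ℝ)).symm.toLinearMap ∘ₗ G)

/-- A linear functional restricted to the Euclidean range of `G`. -/
def restrictFunctional (G : V →ₗ[ℝ] ι → ℝ) (l : (ι → ℝ) →ₗ[ℝ] ℝ) :
    StrongDual ℝ (euclideanRange G) :=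
  LinearMap.toContinuousLinearMap
    (l ∘ₗ (WithLp.linearEquiv 2 ℝ (ι → ℝ)).toLinearMap ∘ₗ (euclideanRange G).subtype)

lemma gaussianImage_eq_map_stdGaussian (m : Measure V) [m.IsAddHaarMeasure]
    {G : V →ₗ[ℝ] ι → ℝ} (hG : Function.Injective G) :
    gaussianImage m G =
      (stdGaussian (euclideanRange G)).map
        fun w : euclideanRange G => WithLp.ofLp (w : EuclideanSpace ℝ ι) := by
  have hinj : Function.Injective ((WithLp.linearEquiv 2 ℝ (ι → ℝ)).symm.toLinearMap ∘ₗ G) :=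
    (WithLp.linearEquiv 2 ℝ (ι → ℝ)).symm.injective.comp hG
  let e : V ≃L[ℝ] euclideanRange G :=
    (LinearEquiv.ofInjective _ hinj).toContinuousLinearEquiv
  have hincl : Measurable fun w : euclideanRange G => WithLp.ofLp (w : EuclideanSpace ℝ ι) := by
    fun_prop
  have hmap : m.map G =
      (m.map e).map fun w : euclideanRange G => WithLp.ofLp (w : EuclideanSpace ℝ ι) := by
    rw [Measure.map_map hincl e.continuous.measurable]
    rfl
  have hf : Measurable fun η : ι → ℝ =>
      ENNReal.ofReal (Real.exp (-(1 / 2 * ∑ b, η b ^ 2))) := by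
    fun_prop
  have : (m.map e).IsAddHaarMeasure := e.isAddHaarMeasure_map m
  have hfe : ((fun η : ι → ℝ => ENNReal.ofReal (Real.exp (-(1 / 2 * ∑ b, η b ^ 2)))) ∘
      fun w : euclideanRange G => WithLp.ofLp (w : EuclideanSpace ℝ ι)) =
      fun w => ENNReal.ofReal (Real.exp (-(1 / 2 * ‖w‖ ^ 2))) := by
    ext w
    simp only [Function.comp_apply, Submodule.coe_norm, EuclideanSpace.real_norm_sq_eq]
  rw [gaussianImage, hmap, withDensity_map _ hincl hf, lintegral_map hf hincl, ← Measure.map_smul,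
    ← normalized_addHaar_withDensity_eq_stdGaussian (m.map e)]
  rw [hfe]
  congr! 5
  simp only [Submodule.coe_norm, EuclideanSpace.real_norm_sq_eq]

lemma variance_gaussianImage (m : Measure V) [m.IsAddHaarMeasure]
    {G : V →ₗ[ℝ] ι → ℝ} (hG : Function.Injective G) (l : (ι → ℝ) →ₗ[ℝ] ℝ) :
    variance l (gaussianImage m G) = ‖restrictFunctional G l‖ ^ 2 := by
  have hl : Continuous l := l.continuous_of_finiteDimensional
  rw [gaussianImage_eq_map_stdGaussian m hG,
    variance_map hl.measurable.aemeasurable (by fun_prop), ← variance_dual_stdGaussian]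
  rfl

lemma variance_gaussianImage_le (m : Measure V) [m.IsAddHaarMeasure]
    {G : V →ₗ[ℝ] ι → ℝ} (hG : Function.Injective G) (l : (ι → ℝ) →ₗ[ℝ] ℝ) {C : ℝ} (hC : 0 ≤ C)
    (h : ∀ v, l (G v) ^ 2 ≤ C * ∑ b, G v b ^ 2) :
    variance l (gaussianImage m G) ≤ C := by
  rw [variance_gaussianImage m hG,
    ← Real.le_sqrt (ContinuousLinearMap.opNorm_nonneg (restrictFunctional G l)) hC]
  refine ContinuousLinearMap.opNorm_le_bound _ (Real.sqrt_nonneg _) ?_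
  rintro ⟨_, v, rfl⟩
  refine abs_le_of_sq_le_sq ?_ (mul_nonneg (Real.sqrt_nonneg C) (norm_nonneg _))
  rw [mul_pow, Real.sq_sqrt hC, Submodule.coe_norm, EuclideanSpace.real_norm_sq_eq]
  exact h v

lemma variance_gaussianImage_mono (m : Measure V) [m.IsAddHaarMeasure] (m' : Measure V')
    [m'.IsAddHaarMeasure] {G : V →ₗ[ℝ] ι → ℝ} (hG : Function.Injective G)
    {G' : V' →ₗ[ℝ] ι → ℝ} (hG' : Function.Injective G') (h : ∀ v, ∃ v', G' v' = G v)
    (l : (ι → ℝ) →ₗ[ℝ] ℝ) :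
    variance l (gaussianImage m G) ≤ variance l (gaussianImage m' G') := by
  rw [variance_gaussianImage m hG, variance_gaussianImage m' hG']
  gcongr
  refine ContinuousLinearMap.opNorm_le_bound _ (ContinuousLinearMap.opNorm_nonneg _) ?_
  rintro ⟨w, v, rfl⟩
  obtain ⟨v', hv'⟩ := h v
  have hmem : (WithLp.linearEquiv 2 ℝ (ι → ℝ)).symm (G v) ∈ euclideanRange G' :=
    ⟨v', by simp [hv']⟩
  exact (restrictFunctional G' l).le_opNorm ⟨_, hmem⟩

end GaussianMeasure

section GridEstimate

lemma sum_range_succ_mul_sub (g : ℕ → ℝ) (n : ℕ) :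
    ∑ y ∈ Finset.range n, ((y : ℝ) + 1) * (g (y + 1) - g y) =
      n * g n - ∑ y ∈ Finset.range n, g y := by
  induction n with
  | zero => simp
  | succ n ih => rw [Finset.sum_range_succ, Finset.sum_range_succ, ih]; push_cast; ring

/-- Average of `f` over the first `r + 1` points of column `r`. -/
def columnMean (f : ℕ → ℕ → ℝ) (r : ℕ) : ℝ :=
  (∑ y ∈ Finset.range (r + 1), f r y) / (r + 1)

/-- Squared increments of `f` between columns `r` and `r + 1` of the wedge and along column
`r + 1`. -/
def layerEnergy (f : ℕ → ℕ → ℝ) (r : ℕ) : ℝ :=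
  ∑ y ∈ Finset.range (r + 1),
    ((f (r + 1) y - f r y) ^ 2 + (f (r + 1) (y + 1) - f (r + 1) y) ^ 2)

lemma columnMean_succ_sub (f : ℕ → ℕ → ℝ) (r : ℕ) :
    columnMean f (r + 1) - columnMean f r =
      (∑ y ∈ Finset.range (r + 1), ((f (r + 1) y - f r y) +
        ((y : ℝ) + 1) / (r + 2) * (f (r + 1) (y + 1) - f (r + 1) y))) / (r + 1) := by
  have h := sum_range_succ_mul_sub (f (r + 1)) (r + 1)
  have h1 : ∑ y ∈ Finset.range (r + 1),
      ((y : ℝ) + 1) / (r + 2) * (f (r + 1) (y + 1) - f (r + 1) y) =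
      ((r + 1) * f (r + 1) (r + 1) - ∑ y ∈ Finset.range (r + 1), f (r + 1) y) / (r + 2) := by
    push_cast at h
    rw [← h, Finset.sum_div]
    exact Finset.sum_congr rfl fun _ _ => by ring
  rw [Finset.sum_add_distrib, Finset.sum_sub_distrib, h1, columnMean, columnMean,
    Finset.sum_range_succ (fun y => f (r + 1) y) (r + 1)]
  push_cast
  field_simp
  ring

lemma columnMean_succ_sub_sq_le (f : ℕ → ℕ → ℝ) (r : ℕ) :
    (columnMean f (r + 1) - columnMean f r) ^ 2 ≤ 2 / (r + 1) * layerEnergy f r := by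
  have hr : (0 : ℝ) < r + 1 := by positivity
  rw [columnMean_succ_sub, div_pow, div_le_iff₀ (by positivity)]
  refine sq_sum_le_card_mul_sum_sq.trans ?_
  rw [Finset.card_range]
  have hle : ∑ y ∈ Finset.range (r + 1), ((f (r + 1) y - f r y) +
      ((y : ℝ) + 1) / (r + 2) * (f (r + 1) (y + 1) - f (r + 1) y)) ^ 2 ≤
      2 * layerEnergy f r := by
    rw [layerEnergy, Finset.mul_sum]
    refine Finset.sum_le_sum fun y hy => ?_
    have hy' : (y : ℝ) + 1 ≤ r + 1 := by exact_mod_cast Finset.mem_range.1 hy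
    have hc : ((y : ℝ) + 1) / (r + 2) ≤ 1 := (div_le_one (by positivity)).2 (by linarith)
    have hc0 : 0 ≤ ((y : ℝ) + 1) / (r + 2) := by positivity
    set c := ((y : ℝ) + 1) / (r + 2)
    set v := f (r + 1) (y + 1) - f (r + 1) y
    have hv : (c * v) ^ 2 ≤ v ^ 2 := by
      rw [mul_pow]
      exact mul_le_of_le_one_left (sq_nonneg v) (pow_le_one₀ hc0 hc)
    linarith [add_sq_le (a := f (r + 1) y - f r y) (b := c * v)]
  calc ((r + 1 : ℕ) : ℝ) * _ ≤ (r + 1) * (2 * layerEnergy f r) := by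
        push_cast
        gcongr
    _ = _ := by field_simp

lemma columnMean_sub_zero_sq_le (f : ℕ → ℕ → ℝ) (N : ℕ) :
    (columnMean f N - columnMean f 0) ^ 2 ≤
      2 * (1 + Real.log N) * ∑ r ∈ Finset.range N, layerEnergy f r := by
  rw [← Finset.sum_range_sub]
  have h0 : ∀ r, 0 ≤ layerEnergy f r := fun r => Finset.sum_nonneg fun _ _ => by positivity
  refine (Finset.sum_sq_le_sum_mul_sum_of_sq_le_mul _ (fun r _ => by positivity)
    (fun r _ => h0 r) fun r _ => columnMean_succ_sub_sq_le f r).trans ?_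
  refine mul_le_mul_of_nonneg_right ?_ (Finset.sum_nonneg fun r _ => h0 r)
  have h := harmonic_le_one_add_log N
  rw [harmonic] at h
  push_cast at h
  calc ∑ r ∈ Finset.range N, 2 / ((r : ℝ) + 1) = 2 * ∑ r ∈ Finset.range N, ((r : ℝ) + 1)⁻¹ := by
        rw [Finset.mul_sum]; rfl
    _ ≤ _ := by gcongr

end GridEstimate

section TorusEstimate

variable {L : ℕ}

lemma grad_horizontal (φ : Torus L → ℝ) (x : Torus L) :
    grad φ (x, true) = φ (x + (1, 0)) - φ x := by
  simp [grad, etarget, estep]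

lemma grad_vertical (φ : Torus L → ℝ) (x : Torus L) :
    grad φ (x, false) = φ (x + (0, 1)) - φ x := by
  simp [grad, etarget, estep]

variable [NeZero L]

lemma sum_range_natCast_zmod (F : ZMod L → ℝ) :
    ∑ i ∈ Finset.range L, F i = ∑ x, F x := by
  refine Finset.sum_bij' (fun i _ => (i : ZMod L)) (fun x _ => x.val) (by simp)
    (fun x _ => Finset.mem_range.2 x.val_lt) (fun i hi => ?_) (by simp) (by simp)
  exact ZMod.val_cast_of_lt (Finset.mem_range.1 hi)

lemma sum_wedge_le_sum_torus {F : Torus L → ℝ} (hF : ∀ x, 0 ≤ F x) {N : ℕ} (hN : N ≤ L) :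
    ∑ r ∈ Finset.range N, ∑ y ∈ Finset.range (r + 1), F ((r : ZMod L), (y : ZMod L)) ≤
      ∑ x, F x := by
  rw [Fintype.sum_prod_type, ← sum_range_natCast_zmod]
  refine (Finset.sum_le_sum fun r hr => ?_).trans
    (Finset.sum_le_sum_of_subset_of_nonneg (Finset.range_mono hN) fun r _ _ =>
      Finset.sum_nonneg fun y _ => hF _)
  rw [← sum_range_natCast_zmod]
  exact Finset.sum_le_sum_of_subset_of_nonneg
    (Finset.range_mono ((Nat.succ_le_of_lt (Finset.mem_range.1 hr)).trans hN)) fun y _ _ => hF _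

lemma sum_edge (F : Edge L → ℝ) :
    ∑ b, F b = ∑ x, F (x, true) + ∑ x, F (x, false) := by
  rw [Fintype.sum_prod_type, ← Finset.sum_add_distrib]
  simp

lemma sum_layerEnergy_le (φ : Torus L → ℝ) {N : ℕ} (hN : N ≤ L) :
    ∑ r ∈ Finset.range N, layerEnergy (fun i j => φ ((i : ZMod L), (j : ZMod L))) r ≤
      ∑ b, grad φ b ^ 2 := by
  rw [sum_edge, ← Equiv.sum_comp (Equiv.addRight ((1, 0) : Torus L))
    (fun x => grad φ (x, false) ^ 2), ← Finset.sum_add_distrib]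
  convert sum_wedge_le_sum_torus (F := fun x => grad φ (x, true) ^ 2 +
    grad φ (Equiv.addRight ((1, 0) : Torus L) x, false) ^ 2) (fun x => by positivity) hN using 4
  simp [layerEnergy, grad_horizontal, grad_vertical]

lemma sum_grad_sq_reflect (φ : Torus L → ℝ) (a : ZMod L) :
    ∑ b, grad (fun x : Torus L => φ (a - x.1, x.2)) b ^ 2 = ∑ b, grad φ b ^ 2 := by
  rw [sum_edge, sum_edge]
  congr 1
  · rw [← Equiv.sum_comp ((Equiv.subLeft (a - 1)).prodCongr (Equiv.refl (ZMod L)))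
      (fun x => grad φ (x, true) ^ 2)]
    refine Finset.sum_congr rfl fun x _ => ?_
    simp only [grad_horizontal, Equiv.prodCongr_apply, Prod.map, Equiv.subLeft_apply,
      Equiv.refl_apply, Prod.fst_add, Prod.snd_add, Prod.mk_add_mk, add_zero]
    rw [sub_sq_comm]
    congr 4 <;> ring
  · rw [← Equiv.sum_comp ((Equiv.subLeft a).prodCongr (Equiv.refl (ZMod L)))
      (fun x => grad φ (x, false) ^ 2)]
    refine Finset.sum_congr rfl fun x _ => ?_
    simp only [grad_vertical, Equiv.prodCongr_apply, Prod.map, Equiv.subLeft_apply,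
      Equiv.refl_apply, Prod.fst_add, Prod.snd_add, Prod.mk_add_mk, add_zero]

lemma sub_sq_le_of_even (φ : Torus L → ℝ) {N : ℕ} (hN : N ≤ L) :
    (φ (((2 * N : ℕ) : ZMod L), 0) - φ 0) ^ 2 ≤
      8 * (1 + Real.log N) * ∑ b, grad φ b ^ 2 := by
  have hlog : 0 ≤ 1 + Real.log N := by have := Real.log_natCast_nonneg N; linarith
  have key : ∀ ψ : Torus L → ℝ, (columnMean (fun i j => ψ ((i : ZMod L), (j : ZMod L))) N -
      ψ 0) ^ 2 ≤ 2 * (1 + Real.log N) * ∑ b, grad ψ b ^ 2 := fun ψ => by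
    have h := columnMean_sub_zero_sq_le (fun i j => ψ ((i : ZMod L), (j : ZMod L))) N
    have h0 : columnMean (fun i j => ψ ((i : ZMod L), (j : ZMod L))) 0 = ψ 0 := by
      simp [columnMean]; rfl
    rw [h0] at h
    exact h.trans (mul_le_mul_of_nonneg_left (sum_layerEnergy_le ψ hN) (by positivity))
  have h1 := key φ
  have h2 := key fun x : Torus L => φ (((2 * N : ℕ) : ZMod L) - x.1, x.2)
  rw [sum_grad_sq_reflect] at h2
  have hcol : columnMean (fun i j => φ (((2 * N : ℕ) : ZMod L) - (i : ZMod L), (j : ZMod L))) N =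
      columnMean (fun i j => φ ((i : ZMod L), (j : ZMod L))) N := by
    have : ((2 * N : ℕ) : ZMod L) - (N : ZMod L) = N := by push_cast; ring
    simp only [columnMean, this]
  simp only [hcol, Prod.fst_zero, Prod.snd_zero, sub_zero] at h2
  set A := columnMean (fun i j => φ ((i : ZMod L), (j : ZMod L))) N
  nlinarith [sq_nonneg ((A - φ 0) + (A - φ (((2 * N : ℕ) : ZMod L), 0)))]

/-- Logarithmic bound for the effective resistance between two points of a horizontal line. -/
lemma sub_sq_le_log_mul_sum_grad_sq (φ : Torus L → ℝ) {m : ℕ} (hm : m ≤ L) :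
    (φ ((m : ZMod L), 0) - φ 0) ^ 2 ≤ 18 * (1 + Real.log m) * ∑ b, grad φ b ^ 2 := by
  have hE : 0 ≤ ∑ b, grad φ b ^ 2 := Finset.sum_nonneg fun b _ => sq_nonneg _
  have hmono : ∀ N : ℕ, N ≤ m → Real.log N ≤ Real.log m := fun N h => by
    rcases N.eq_zero_or_pos with rfl | hN
    · simpa using Real.log_natCast_nonneg m
    · exact Real.log_le_log (by exact_mod_cast hN) (by exact_mod_cast h)
  have hlog := Real.log_natCast_nonneg m
  obtain ⟨N, rfl | rfl⟩ := m.even_or_odd'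
  · refine (sub_sq_le_of_even φ (by omega)).trans (mul_le_mul_of_nonneg_right ?_ hE)
    linarith [hmono N (by omega)]
  · have h1 := sub_sq_le_of_even φ (show N ≤ L by omega)
    have h2 : grad φ ((((2 * N : ℕ) : ZMod L), 0), true) ^ 2 ≤ ∑ b, grad φ b ^ 2 :=
      Finset.single_le_sum (f := fun b => grad φ b ^ 2) (fun b _ => sq_nonneg _)
        (Finset.mem_univ _)
    rw [grad_horizontal, Prod.mk_add_mk, add_zero, ← Nat.cast_succ] at h2
    have h3 : 8 * (1 + Real.log N) * ∑ b, grad φ b ^ 2 ≤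
        8 * (1 + Real.log (2 * N + 1 : ℕ)) * ∑ b, grad φ b ^ 2 := by
      refine mul_le_mul_of_nonneg_right ?_ hE
      linarith [hmono N (by omega)]
    have h4 := mul_nonneg hlog hE
    set a := φ (((2 * N : ℕ) : ZMod L), 0)
    change (φ (((2 * N + 1 : ℕ) : ZMod L), 0) - a) ^ 2 ≤ _ at h2
    nlinarith [sq_nonneg ((φ (((2 * N + 1 : ℕ) : ZMod L), 0) - a) - (a - φ 0))]

end TorusEstimate

section TorusMeasures

variable {L : ℕ}

lemma natCast_fst_invariant {φ : Torus L → ℝ} (h : ∀ x, φ (x + (1, 0)) = φ x) (n : ℕ)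
    (y : ZMod L) : φ ((n : ZMod L), y) = φ (0, y) := by
  induction n with
  | zero => simp
  | succ n ih => rw [← ih, ← h ((n : ZMod L), y)]; simp

lemma natCast_snd_invariant {φ : Torus L → ℝ} (h : ∀ x, φ (x + (0, 1)) = φ x) (n : ℕ)
    (x : ZMod L) : φ (x, (n : ZMod L)) = φ (x, 0) := by
  induction n with
  | zero => simp
  | succ n ih => rw [← ih, ← h (x, (n : ZMod L))]; simp

lemma sum_range_grad_horizontal (φ : Torus L → ℝ) (m : ℕ) :
    ∑ i ∈ Finset.range m, grad φ (((i : ZMod L), 0), true) = φ ((m : ZMod L), 0) - φ 0 := by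
  have h := Finset.sum_range_sub (fun i : ℕ => φ ((i : ZMod L), 0)) m
  simp only [Nat.cast_zero] at h
  rw [← Prod.mk_zero_zero, ← h]
  refine Finset.sum_congr rfl fun i _ => ?_
  rw [grad_horizontal, Prod.mk_add_mk, add_zero, Nat.cast_succ]

variable (L)

/-- Extension by zero at the origin. -/
def extendZero : ({x : Torus L // x ≠ 0} → ℝ) →ₗ[ℝ] Torus L → ℝ where
  toFun ψ x := if h : x = 0 then 0 else ψ ⟨x, h⟩
  map_add' ψ χ := by ext x; by_cases h : x = 0 <;> simp [h]
  map_smul' c ψ := by ext x; by_cases h : x = 0 <;> simp [h]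

lemma extendZero_injective : Function.Injective (extendZero L) := fun ψ χ h => by
  ext ⟨x, hx⟩
  simpa [extendZero, hx] using congrFun h x

/-- The gradient as a linear map. -/
def gradLinear : (Torus L → ℝ) →ₗ[ℝ] Edge L → ℝ where
  toFun := grad
  map_add' φ χ := by ext b; simp [grad]; ring
  map_smul' c φ := by ext b; simp [grad]; ring

/-- The gradient of the extension by zero at the origin. -/
def pinnedGrad : ({x : Torus L // x ≠ 0} → ℝ) →ₗ[ℝ] Edge L → ℝ :=
  gradLinear L ∘ₗ extendZero L

/-- The configuration `s / L²` on horizontal and `t / L²` on vertical edges. -/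
def tilt : (ℝ × ℝ) →ₗ[ℝ] Edge L → ℝ where
  toFun p b := (if b.2 then p.1 else p.2) / (L : ℝ) ^ 2
  map_add' p q := by ext ⟨x, _ | _⟩ <;> simp [add_div]
  map_smul' c p := by ext ⟨x, _ | _⟩ <;> simp [mul_div_assoc]

/-- A pinned gradient plus a tilt. -/
def tiltedGrad : (({x : Torus L // x ≠ 0} → ℝ) × (ℝ × ℝ)) →ₗ[ℝ] Edge L → ℝ :=
  (pinnedGrad L).coprod (tilt L)

/-- `Ym` as a linear functional. -/
def YmLinear (m : ℕ) : (Edge L → ℝ) →ₗ[ℝ] ℝ where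
  toFun η := ∑ i ∈ Finset.range m, η (((i : ZMod L), 0), true)
  map_add' η ξ := by simp [Finset.sum_add_distrib]
  map_smul' c η := by simp [Finset.mul_sum]

variable [NeZero L]

lemma nuL_eq_map : nuL L = Measure.map (pinnedGrad L) volume := by
  have h1 : Measurable (grad : (Torus L → ℝ) → Edge L → ℝ) :=
    (gradLinear L).continuous_of_finiteDimensional.measurable
  have h2 : Measurable (extendZero L) := (extendZero L).continuous_of_finiteDimensional.measurable
  exact Measure.map_map h1 h2

lemma nuStar_eq_map : nuStar L = Measure.map (tiltedGrad L) volume := by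
  have h1 : Measurable (pinnedGrad L) := (pinnedGrad L).continuous_of_finiteDimensional.measurable
  have h2 : Measurable fun q : (Edge L → ℝ) × (ℝ × ℝ) => fun b : Edge L =>
      q.1 b + (if b.2 then q.2.1 else q.2.2) / (L : ℝ) ^ 2 := by
    refine measurable_pi_lambda _ fun b => ?_
    rcases b with ⟨x, _ | _⟩ <;> simp <;> fun_prop
  have h3 : (nuL L).prod (volume : Measure (ℝ × ℝ)) =
      Measure.map (Prod.map (pinnedGrad L) id) volume := by
    rw [nuL_eq_map, ← Measure.map_id (μ := (volume : Measure (ℝ × ℝ))),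
      Measure.map_prod_map _ _ h1 measurable_id]
    rfl
  rw [nuStar, h3, Measure.map_map h2 (h1.prodMap measurable_id)]
  rfl

lemma muL_eq_gaussianImage : muL L = gaussianImage volume (pinnedGrad L) := by
  simp only [muL, gaussianImage, nuL_eq_map, energy, one_mul]

lemma muLstar_eq_gaussianImage : muLstar L = gaussianImage volume (tiltedGrad L) := by
  simp only [muLstar, gaussianImage, nuStar_eq_map, energy, one_mul]

variable {L}

lemma eq_zero_of_grad_eq_zero {φ : Torus L → ℝ} (h0 : φ 0 = 0) (h : ∀ b, grad φ b = 0) :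
    φ = 0 := by
  have hh : ∀ x, φ (x + (1, 0)) = φ x := fun x => by
    rw [← sub_eq_zero, ← grad_horizontal, h]
  have hv : ∀ x, φ (x + (0, 1)) = φ x := fun x => by
    rw [← sub_eq_zero, ← grad_vertical, h]
  ext ⟨x, y⟩
  rw [← ZMod.natCast_zmod_val x, ← ZMod.natCast_zmod_val y, natCast_fst_invariant hh,
    natCast_snd_invariant hv]
  exact h0

lemma pinnedGrad_injective : Function.Injective (pinnedGrad L) := by
  rw [← LinearMap.ker_eq_bot, LinearMap.ker_eq_bot']
  intro ψ hψ
  refine extendZero_injective L ((eq_zero_of_grad_eq_zero ?_ (congrFun hψ)).trans (map_zero _).symm)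
  simp [extendZero]

lemma sum_grad_horizontal (φ : Torus L → ℝ) : ∑ x, grad φ (x, true) = 0 := by
  simp only [grad_horizontal, Finset.sum_sub_distrib]
  rw [sub_eq_zero]
  exact Equiv.sum_comp (Equiv.addRight ((1, 0) : Torus L)) φ

lemma sum_grad_vertical (φ : Torus L → ℝ) : ∑ x, grad φ (x, false) = 0 := by
  simp only [grad_vertical, Finset.sum_sub_distrib]
  rw [sub_eq_zero]
  exact Equiv.sum_comp (Equiv.addRight ((0, 1) : Torus L)) φ

lemma sum_tiltedGrad_sq (v : ({x : Torus L // x ≠ 0} → ℝ) × (ℝ × ℝ)) :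
    ∑ b, tiltedGrad L v b ^ 2 =
      ∑ b, pinnedGrad L v.1 b ^ 2 + (v.2.1 ^ 2 + v.2.2 ^ 2) / (L : ℝ) ^ 2 := by
  have hL : (L : ℝ) ≠ 0 := Nat.cast_ne_zero.2 (NeZero.ne L)
  have key : ∀ (F : Torus L → ℝ) (c : ℝ), ∑ x, F x = 0 →
      ∑ x, (F x + c / (L : ℝ) ^ 2) ^ 2 = ∑ x, F x ^ 2 + c ^ 2 / (L : ℝ) ^ 2 := by
    intro F c hF
    simp only [add_sq, Finset.sum_add_distrib, ← Finset.sum_mul, ← Finset.mul_sum, hF]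
    simp [ZMod.card]
    field_simp
  have h1 := key _ v.2.1 (sum_grad_horizontal (extendZero L v.1))
  have h2 := key _ v.2.2 (sum_grad_vertical (extendZero L v.1))
  rw [sum_edge, sum_edge]
  calc _ = _ := congrArg₂ (· + ·) h1 h2
    _ = _ := by
      simp only [pinnedGrad, gradLinear, LinearMap.comp_apply, LinearMap.coe_mk, AddHom.coe_mk]
      ring

lemma tiltedGrad_injective : Function.Injective (tiltedGrad L) := by
  have hL : (L : ℝ) ≠ 0 := Nat.cast_ne_zero.2 (NeZero.ne L)
  rw [← LinearMap.ker_eq_bot, LinearMap.ker_eq_bot']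
  rintro ⟨ψ, s, t⟩ hv
  have h := sum_tiltedGrad_sq (ψ, s, t)
  rw [hv] at h
  simp only [Pi.zero_apply, ne_eq, OfNat.ofNat_ne_zero, not_false_eq_true, zero_pow,
    Finset.sum_const_zero] at h
  have h1 : 0 ≤ ∑ b, pinnedGrad L ψ b ^ 2 := Finset.sum_nonneg fun b _ => sq_nonneg _
  have h2 : 0 ≤ (s ^ 2 + t ^ 2) / (L : ℝ) ^ 2 := by positivity
  have h3 : (s ^ 2 + t ^ 2) / (L : ℝ) ^ 2 = 0 := by linarith
  have h4 : s ^ 2 + t ^ 2 = 0 := by simpa [hL] using h3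
  have hs : s = 0 := by nlinarith [sq_nonneg t]
  have ht : t = 0 := by nlinarith [sq_nonneg s]
  subst hs ht
  have hψ : pinnedGrad L ψ = 0 := by
    rw [← hv, tiltedGrad, LinearMap.coprod_apply]
    simp [← Prod.mk_zero_zero.symm]
  simp [pinnedGrad_injective (hψ.trans (map_zero _).symm)]

lemma YmLinear_tiltedGrad_sq_le {m : ℕ} (hm : m ≤ L)
    (v : ({x : Torus L // x ≠ 0} → ℝ) × (ℝ × ℝ)) :
    YmLinear L m (tiltedGrad L v) ^ 2 ≤
      36 * (1 + Real.log m) * ∑ b, tiltedGrad L v b ^ 2 := by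
  have hL : (0 : ℝ) < L := Nat.cast_pos.2 (NeZero.pos L)
  set φ := extendZero L v.1 with hφ
  have hY : YmLinear L m (tiltedGrad L v) =
      (φ ((m : ZMod L), 0) - φ 0) + m * (v.2.1 / (L : ℝ) ^ 2) := by
    rw [tiltedGrad, LinearMap.coprod_apply, map_add, ← sum_range_grad_horizontal]
    simp [YmLinear, tilt, pinnedGrad, gradLinear, hφ]
  rw [hY, sum_tiltedGrad_sq]
  have h1 : (φ ((m : ZMod L), 0) - φ 0) ^ 2 ≤
      18 * (1 + Real.log m) * ∑ b, pinnedGrad L v.1 b ^ 2 := sub_sq_le_log_mul_sum_grad_sq φ hm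
  have h2 : (m * (v.2.1 / (L : ℝ) ^ 2)) ^ 2 ≤ (v.2.1 ^ 2 + v.2.2 ^ 2) / (L : ℝ) ^ 2 := by
    have hml : (m : ℝ) ≤ L := by exact_mod_cast hm
    calc (m * (v.2.1 / (L : ℝ) ^ 2)) ^ 2 ≤ (L * (v.2.1 / (L : ℝ) ^ 2)) ^ 2 := by
          rw [mul_pow, mul_pow]
          gcongr
      _ = v.2.1 ^ 2 / (L : ℝ) ^ 2 := by field_simp
      _ ≤ _ := by gcongr; linarith [sq_nonneg v.2.2]
  have hlog := Real.log_natCast_nonneg m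
  have h3 : 0 ≤ (v.2.1 ^ 2 + v.2.2 ^ 2) / (L : ℝ) ^ 2 := by positivity
  have h4 := mul_nonneg hlog h3
  have h5 := add_sq_le (a := φ ((m : ZMod L), 0) - φ 0) (b := m * (v.2.1 / (L : ℝ) ^ 2))
  linarith

end TorusMeasures

/-- logarithmic variance bounds for `Y_m` under `μ_L` and
`μ*_L`. -/
theorem variance_Ym_bound :
    ∃ c₃ : ℝ, 0 < c₃ ∧ ∀ (L : ℕ) [NeZero L], Even L → 2 ≤ L →
      ∀ m : ℕ, 1 ≤ m → m ≤ L →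
        ProbabilityTheory.variance (Ym L m) (muL L) ≤
            ProbabilityTheory.variance (Ym L m) (muLstar L) ∧
          ProbabilityTheory.variance (Ym L m) (muLstar L) ≤
            c₃ * (1 + Real.log m) := by
  refine ⟨36, by norm_num, fun L _ _ _ m _ hm => ?_⟩
  rw [muL_eq_gaussianImage, muLstar_eq_gaussianImage]
  have hlog := Real.log_natCast_nonneg m
  have : (volume : Measure (({x : Torus L // x ≠ 0} → ℝ) × (ℝ × ℝ))).IsAddHaarMeasure :=
    Measure.prod.instIsAddHaarMeasure volume volume
  exact ⟨variance_gaussianImage_mono volume volume pinnedGrad_injective tiltedGrad_injective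
      (fun ψ => ⟨(ψ, 0), by simp [tiltedGrad]⟩) (YmLinear L m),
    variance_gaussianImage_le volume tiltedGrad_injective (YmLinear L m) (by positivity)
      (YmLinear_tiltedGrad_sq_le hm)⟩

end
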